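/- Let n, m, k be positive integers, Σ a constant m×k real matrix, and let F : ℝⁿ → ℝ^{n×m}, A : ℝⁿ → ℝ^{m×m}, J : ℝⁿ → ℝ^{m×m} be functions with F continuously differentiable, such that at every x ∈ ℝⁿ: J(x) is symmetric and A(x) J(x) + J(x) A(x)ᵀ = −Σ Σᵀ. Define A₁ = F·A (matrix product pointwise), the noise-induced drift S with components Sⁱ(x) = −Σ_{l,j,p} ∂F^{ij}/∂x^l (x) · A₁^{lp}(x) · J^{jp}(x), and H with components Hⁱ(x) = Sⁱ(x) − (1/2) Σ_{j,p} ∂(FΣ)^{ip}/∂x^j (x) · (FΣ)^{jp}(x). Let G_q(x) ∈ ℝⁿ denote the q-th column of F(x), with Lie bracket [G_q, G_j]ⁱ = Σ_l (G_q^l ∂G_j^i/∂x^l − G_j^l ∂G_q^i/∂x^l), and let Q(x) = (J(x) A(x)ᵀ − A(x) J(x))/2. Then for every x and every i: Hⁱ(x) = (1/2) Σ_{q,j} Q^{qj}(x) [G_q, G_j]ⁱ(x). -/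

import Mathlib

open Matrix Finset

/-- Partial derivative `∂f/∂x^l` of a real-valued function on `ℝⁿ`. -/
noncomputable def pderiv {n : ℕ} (l : Fin n) (f : (Fin n → ℝ) → ℝ) (x : Fin n → ℝ) : ℝ :=
  fderiv ℝ f x (Pi.single l 1)

/-- The partial derivative of an entry of `F * S`, for a constant matrix `S`. -/
theorem pderiv_mul_const_apply {n m k : ℕ} {F : (Fin n → ℝ) → Matrix (Fin n) (Fin m) ℝ}
    {x : Fin n → ℝ} {i : Fin n} (hF : ∀ q, DifferentiableAt ℝ (fun y => F y i q) x)
    (S : Matrix (Fin m) (Fin k) ℝ) (l : Fin n) (p : Fin k) :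
    pderiv l (fun y => (F y * S) i p) x = ∑ q, pderiv l (fun y => F y i q) x * S q p := by
  simp only [pderiv, Matrix.mul_apply]
  rw [fderiv_fun_sum fun q _ => (hF q).mul_const (S q p), _root_.sum_apply]
  refine Finset.sum_congr rfl fun q _ => ?_
  rw [fderiv_mul_const (hF q)]
  simp [mul_comm]

/-- Pairing an antisymmetrized matrix with `W - Wᵀ` doubles its pairing with `W`. -/
theorem sum_antisymm_mul_sub {m : ℕ} (M W : Matrix (Fin m) (Fin m) ℝ) :
    ∑ q, ∑ j, (M j q - M q j) * (W j q - W q j) =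
      2 * ((W * Mᵀ).trace - (W * M).trace) := by
  have hswap (f : Fin m → Fin m → ℝ) : ∑ q, ∑ j, f q j = ∑ q, ∑ j, f j q := Finset.sum_comm
  have hsym := hswap fun q j => W j q * M j q
  have hmul := hswap fun q j => W j q * M q j
  simp only [Matrix.trace, Matrix.diag_apply, Matrix.mul_apply, Matrix.transpose_apply, sub_mul,
    mul_sub, Finset.sum_sub_distrib, mul_comm (M _ _)]
  linarith

/-- The Stratonovich drift correction `H` equals `(1/2) Q^{qj} [G_q, G_j]`: with `A₁ = F·A`,
`J` the pointwise solution of the Lyapunov equation `A J + J Aᵀ = −Σ Σᵀ`, `Q` the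
antisymmetric part of the Onsager matrix `−A J`, and `G_q` the column vector fields of `F`. -/
theorem stratonovich_drift_eq_lie_bracket {n m k : ℕ} (hn : 0 < n) (hm : 0 < m) (hk : 0 < k)
    (Sig : Matrix (Fin m) (Fin k) ℝ)
    (F : (Fin n → ℝ) → Matrix (Fin n) (Fin m) ℝ)
    (A J : (Fin n → ℝ) → Matrix (Fin m) (Fin m) ℝ)
    (hF : ∀ i j, ContDiff ℝ 1 fun x => F x i j)
    (hJsymm : ∀ x, (J x)ᵀ = J x)
    (hLyap : ∀ x, A x * J x + J x * (A x)ᵀ = -(Sig * Sigᵀ)) :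
    ∀ (x : Fin n → ℝ) (i : Fin n),
      (-(∑ l : Fin n, ∑ j : Fin m, ∑ p : Fin m,
            pderiv l (fun y => F y i j) x * (F x * A x) l p * J x j p)
        - (1 / 2 : ℝ) * ∑ j : Fin n, ∑ p : Fin k,
            pderiv j (fun y => (F y * Sig) i p) x * (F x * Sig) j p)
      = (1 / 2 : ℝ) * ∑ q : Fin m, ∑ j : Fin m,
          ((1 / 2 : ℝ) • (J x * (A x)ᵀ - A x * J x)) q j *
            (∑ l : Fin n,
              (F x l q * pderiv l (fun y => F y i j) x
                - F x l j * pderiv l (fun y => F y i q) x)) := by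
  intro x i
  let D : Matrix (Fin m) (Fin n) ℝ := Matrix.of fun j l => pderiv l (fun y => F y i j) x
  have hdrift : ∑ l : Fin n, ∑ j : Fin m, ∑ p : Fin m,
      pderiv l (fun y => F y i j) x * (F x * A x) l p * J x j p =
        (D * F x * (A x * J x)).trace := by
    have hassoc : D * F x * (A x * J x) = D * (F x * A x) * (J x)ᵀ := by
      simp only [hJsymm, Matrix.mul_assoc]
    rw [hassoc, Finset.sum_comm]
    simp only [Matrix.trace, Matrix.diag_apply, Matrix.mul_apply (M := D * (F x * A x)),
      Matrix.mul_apply (M := D), Matrix.transpose_apply, Finset.sum_mul]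
    exact Finset.sum_congr rfl fun j _ => Finset.sum_comm
  have hnoise : ∑ j : Fin n, ∑ p : Fin k,
      pderiv j (fun y => (F y * Sig) i p) x * (F x * Sig) j p =
        (D * F x * (Sig * Sigᵀ)).trace := by
    have hassoc : D * F x * (Sig * Sigᵀ) = D * (F x * Sig) * Sigᵀ := by
      simp only [Matrix.mul_assoc]
    rw [hassoc]
    simp only [pderiv_mul_const_apply
      fun q => ((hF i q).differentiable one_ne_zero).differentiableAt]
    simp only [Matrix.trace, Matrix.diag_apply, Matrix.mul_apply (M := D * (F x * Sig)),
      Matrix.mul_apply (M := D), Matrix.transpose_apply, Finset.sum_mul]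
    rw [Finset.sum_congr rfl fun j _ => Finset.sum_comm, Finset.sum_comm]
    refine Finset.sum_congr rfl fun q _ => ?_
    rw [Finset.sum_comm]
    refine Finset.sum_congr rfl fun p _ => Finset.sum_congr rfl fun j _ => ?_
    simp only [D, Matrix.of_apply]
    ring
  have hbracket (q j : Fin m) : ∑ l : Fin n,
      (F x l q * pderiv l (fun y => F y i j) x - F x l j * pderiv l (fun y => F y i q) x) =
        (D * F x) j q - (D * F x) q j := by
    simp only [Matrix.mul_apply, D, Matrix.of_apply, Finset.sum_sub_distrib, mul_comm (F x _ _)]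
  have htr : J x * (A x)ᵀ = (A x * J x)ᵀ := by rw [Matrix.transpose_mul, hJsymm]
  have hSig : Sig * Sigᵀ = -(A x * J x + (A x * J x)ᵀ) := by
    rw [← htr, hLyap, neg_neg]
  have hpair := sum_antisymm_mul_sub (A x * J x) (D * F x)
  rw [hdrift, hnoise, hSig, htr]
  simp only [hbracket, Matrix.smul_apply, Matrix.sub_apply, Matrix.transpose_apply, smul_eq_mul,
    mul_assoc (1 / 2 : ℝ), ← Finset.mul_sum]
  rw [hpair, Matrix.mul_neg, Matrix.mul_add, Matrix.trace_neg, Matrix.trace_add]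
  ring
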